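/- arXiv:2112.15205 — 2 statements merged into one kernel-verified Lean document; each statement's English description precedes it below -/
import Mathlib

section
/- Let d ≥ 1. For a nonzero vector a = (a₀,…,a_d) ∈ ℝ^{d+1} let P_a = Σ_{i=0}^{d} a_i X^i, let d' be the degree of P_a, and define the marked pattern of a to be (ω, d − d'), where ω is the real root multiplicity pattern of P_a (the marked pattern always lies in Ω^∞_{⟨d]}). Then for every Θ ⊆ Ω^∞_{⟨d]}, the set {a ∈ ℝ^{d+1} ∖ {0} : the marked pattern of a lies in Θ} is closed in ℝ^{d+1} ∖ {0} if and only if for every x ∈ Θ and every marked composition y with y ⪯ x and |y| ≤ d one has y ∈ Θ. (This set is invariant under nonzero scalings, so the statement is equivalent to the closedness of B_d^Θ in the projective space B_d ≅ ℝP^d.) -/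
/-- A composition: a (possibly empty) list of positive integers. -/
abbrev Comp : Type := List PNat

/-- A marked composition: a composition together with a mark `κ : ℕ`. -/
abbrev MComp : Type := List PNat × ℕ

/-- The norm `|ω|` of a composition. -/
def normC (ω : Comp) : ℕ := (ω.map fun a => (a : ℕ)).sum

/-- The reduced norm `|ω|' = |ω| - ℓ` of a composition. -/
def rnormC (ω : Comp) : ℕ := normC ω - ω.length

/-- The norm of a marked composition. -/
def normM (x : MComp) : ℕ := normC x.1 + x.2

/-- The reduced norm of a marked composition. -/
def rnormM (x : MComp) : ℕ := rnormC x.1 + x.2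

/-- Merge the parts at (0-indexed) positions `k` and `k+1` of a composition. -/
def mergeAux : Comp → ℕ → Comp
  | a :: b :: t, 0 => (a + b) :: t
  | a :: t, n + 1 => a :: mergeAux t n
  | l, _ => l

/-- The merge operation `M_k^∞` (`0 ≤ k ≤ ℓ`) on marked compositions:
`M_0^∞` moves the first part to the mark, `M_ℓ^∞` moves the last part to the mark, and
for `1 ≤ k ≤ ℓ-1`, `M_k^∞` merges the `k`-th and `(k+1)`-st parts (1-indexed). -/
def mergeM (x : MComp) (k : ℕ) : MComp :=
  if k = 0 then
    match x.1 with
    | [] => x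
    | a :: t => (t, x.2 + (a : ℕ))
  else if k = x.1.length then
    match x.1.getLast? with
    | none => x
    | some a => (x.1.dropLast, x.2 + (a : ℕ))
  else (mergeAux x.1 (k - 1), x.2)

/-- The insert operation `I_k` (`0 ≤ k ≤ ℓ`): insert a part `2` after the first `k` parts. -/
def insertC (ω : Comp) (k : ℕ) : Comp := ω.take k ++ (2 : PNat) :: ω.drop k

/-- The insert operation `I_k^∞` on marked compositions. -/
def insertM (x : MComp) (k : ℕ) : MComp := (insertC x.1 k, x.2)

/-- One merge or insert step on marked compositions: `mstep y x` means `x` is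
obtained from `y` by a single operation. -/
def mstep (y x : MComp) : Prop :=
  (∃ k ≤ y.1.length, y.1 ≠ [] ∧ x = mergeM y k) ∨ ∃ k ≤ y.1.length, x = insertM y k

/-- `mprec x y` is the relation `x ⪯ y` on marked compositions. -/
def mprec (x y : MComp) : Prop := Relation.ReflTransGen mstep y x

/-- One merge or insert step on compositions: merges `M_j`, `1 ≤ j ≤ ℓ-1`
(0-indexed: positions `k, k+1` with `k + 2 ≤ ℓ`), and all inserts. -/
def cstep (y x : Comp) : Prop :=
  (∃ k, k + 2 ≤ y.length ∧ x = mergeAux y k) ∨ ∃ k ≤ y.length, x = insertC y k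

/-- `cprec x y` is the relation `x ⪯ y` on compositions. -/
def cprec (x y : Comp) : Prop := Relation.ReflTransGen cstep y x

/-- `P` has real root multiplicity pattern `ω`: there are reals `x₁ < ⋯ < x_ℓ` such that
`x_i` is a root of `P` of multiplicity exactly `ω_i`, and `P` has no other real roots. -/
def hasPattern (P : Polynomial ℝ) (ω : Comp) : Prop :=
  P ≠ 0 ∧ ∃ x : Fin ω.length → ℝ, StrictMono x ∧
    (∀ i : Fin ω.length, Polynomial.rootMultiplicity (x i) P = (ω.get i : ℕ)) ∧
    ∀ y : ℝ, P.IsRoot y → ∃ i : Fin ω.length, y = x i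

/-- The polynomial `Σ_{i=0}^{d} a_i X^i` attached to `a ∈ ℝ^{d+1}`. -/
noncomputable def polyOfVec (d : ℕ) (a : Fin (d + 1) → ℝ) : Polynomial ℝ :=
  ∑ i : Fin (d + 1), Polynomial.C (a i) * Polynomial.X ^ (i : ℕ)

/-- The marked pattern of `a ∈ ℝ^{d+1}` is `(ω, d - d')`, where `ω` is the real root
multiplicity pattern of `P_a` and `d'` is the degree of `P_a`. -/
def markedPattern (d : ℕ) (a : Fin (d + 1) → ℝ) (x : MComp) : Prop :=
  hasPattern (polyOfVec d a) x.1 ∧ x.2 = d - (polyOfVec d a).natDegree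


open Polynomial

theorem normC_nil : normC [] = 0 := rfl
theorem normC_cons (a : PNat) (t : Comp) : normC (a :: t) = a + normC t := by simp [normC]
theorem normC_append (s t : Comp) : normC (s ++ t) = normC s + normC t := by simp [normC]

/-- Product of powers of `X - r`. -/
noncomputable def rp (l : List (ℝ × PNat)) : ℝ[X] :=
  (l.map fun p => (X - C p.1) ^ (p.2 : ℕ)).prod

theorem rp_nil : rp [] = 1 := rfl
theorem rp_cons (p : ℝ × PNat) (l : List (ℝ × PNat)) :
    rp (p :: l) = (X - C p.1) ^ (p.2 : ℕ) * rp l := by simp [rp]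
theorem rp_append (s t : List (ℝ × PNat)) : rp (s ++ t) = rp s * rp t := by simp [rp]

theorem rp_monic (l : List (ℝ × PNat)) : (rp l).Monic := by
  induction l with
  | nil => exact monic_one
  | cons p l ih => rw [rp_cons]; exact ((monic_X_sub_C _).pow _).mul ih

theorem rp_natDegree (l : List (ℝ × PNat)) : (rp l).natDegree = normC (l.map Prod.snd) := by
  induction l with
  | nil => simp [rp_nil, normC_nil]
  | cons p l ih =>
    rw [rp_cons, ((monic_X_sub_C _).pow _).natDegree_mul (rp_monic l), ih,
      (monic_X_sub_C _).natDegree_pow]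
    simp [normC_cons]

theorem rp_mult_of_notMem (l : List (ℝ × PNat)) (y : ℝ) (hy : ∀ p ∈ l, p.1 ≠ y) :
    rootMultiplicity y (rp l) = 0 := by
  apply rootMultiplicity_eq_zero
  induction l with
  | nil => simp [rp_nil]
  | cons p l ih =>
    rw [rp_cons, IsRoot.def, eval_mul]
    have h1 := ih (fun q hq => hy q (by simp [hq]))
    have h2 := hy p (by simp)
    simp only [eval_pow, eval_sub, eval_X, eval_C]
    exact mul_ne_zero (pow_ne_zero _ (sub_ne_zero.2 h2.symm)) h1

/-- strictly sorted by first coordinate -/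
def SS (l : List (ℝ × PNat)) : Prop := l.Pairwise fun p q => p.1 < q.1

theorem rp_mult (l : List (ℝ × PNat)) (hl : SS l) (p : ℝ × PNat) (hp : p ∈ l) :
    rootMultiplicity p.1 (rp l) = (p.2 : ℕ) := by
  induction l with
  | nil => simp at hp
  | cons q l ih =>
    rw [SS, List.pairwise_cons] at hl
    have hne : (X - C q.1) ^ (q.2 : ℕ) * rp l ≠ 0 := by
      rw [← rp_cons]; exact (rp_monic _).ne_zero
    rw [rp_cons, rootMultiplicity_mul hne]
    rcases List.mem_cons.1 hp with rfl | h
    · rw [rootMultiplicity_X_sub_C_pow, rp_mult_of_notMem l _ (fun q hq => (hl.1 q hq).ne')]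
      rfl
    · rw [ih hl.2 h, rootMultiplicity_eq_zero]
      · simp
      · simp only [IsRoot.def, eval_pow, eval_sub, eval_X, eval_C]
        exact pow_ne_zero _ (sub_ne_zero.2 (hl.1 p h).ne')

theorem hasPattern_iff (P : ℝ[X]) (ω : Comp) :
    hasPattern P ω ↔ P ≠ 0 ∧ ∃ l : List (ℝ × PNat), l.map Prod.snd = ω ∧ SS l ∧
      (∀ p ∈ l, rootMultiplicity p.1 P = (p.2 : ℕ)) ∧ ∀ y, P.IsRoot y → ∃ p ∈ l, p.1 = y := by
  unfold hasPattern
  refine and_congr_right fun _ => ⟨?_, ?_⟩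
  · rintro ⟨x, hx, hm, hr⟩
    refine ⟨List.ofFn fun i => (x i, ω.get i), ?_, ?_, ?_, ?_⟩
    · rw [List.map_ofFn]
      exact List.ofFn_get ω
    · rw [SS, List.pairwise_ofFn]
      intro i j hij
      exact hx hij
    · intro p hp
      obtain ⟨i, rfl⟩ := (List.mem_ofFn' _ _).1 hp
      exact hm i
    · intro y hy
      obtain ⟨i, rfl⟩ := hr y hy
      exact ⟨_, (List.mem_ofFn' _ _).2 ⟨i, rfl⟩, rfl⟩
  · rintro ⟨l, rfl, hs, hm, hr⟩
    refine ⟨fun i => (l.get (i.cast (by simp))).1, ?_, ?_, ?_⟩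
    · intro i j hij
      exact List.pairwise_iff_get.1 hs _ _ hij
    · intro i
      rw [hm _ (List.get_mem _ _)]
      simp
    · intro y hy
      obtain ⟨p, hp, rfl⟩ := hr y hy
      obtain ⟨i, rfl⟩ := List.get_of_mem hp
      exact ⟨i.cast (by simp), rfl⟩

theorem hasPattern_unique {P : ℝ[X]} {ω ω' : Comp} (h : hasPattern P ω) (h' : hasPattern P ω') :
    ω = ω' := by
  obtain ⟨h0, l, rfl, hs, hm, hr⟩ := (hasPattern_iff _ _).1 h
  obtain ⟨_, l', rfl, hs', hm', hr'⟩ := (hasPattern_iff _ _).1 h'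
  have key : ∀ l l' : List (ℝ × PNat), (∀ p ∈ l, rootMultiplicity p.1 P = (p.2 : ℕ)) →
      (∀ p ∈ l', rootMultiplicity p.1 P = (p.2 : ℕ)) →
      (∀ y, P.IsRoot y → ∃ p ∈ l', p.1 = y) → l ⊆ l' := by
    intro l l' hm hm' hr p hp
    have h1 := hm p hp
    have : P.IsRoot p.1 := by
      rw [← rootMultiplicity_pos h0, h1]; exact p.2.pos
    obtain ⟨q, hq, hqp⟩ := hr _ this
    have h2 := hm' q hq
    rw [hqp, h1] at h2
    have : p = q := Prod.ext hqp.symm (PNat.coe_injective h2)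
    exact this ▸ hq
  have nd : ∀ l : List (ℝ × PNat), SS l → l.Nodup := fun l hl =>
    List.Pairwise.imp (fun h e => by simp [e] at h) hl
  have hperm : l.Perm l' := (List.perm_ext_iff_of_nodup (nd _ hs) (nd _ hs')).2 fun p =>
    ⟨fun h => key l l' hm hm' hr' h, fun h => key l' l hm' hm hr h⟩
  congr 1
  exact hperm.eq_of_pairwise (fun a b _ _ h1 h2 => absurd (lt_trans h1 h2) (lt_irrefl _)) hs hs'

theorem hasPattern_of (l : List (ℝ × PNat)) (hl : SS l) (R : ℝ[X]) (hR : ∀ y, ¬ R.IsRoot y) :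
    hasPattern (rp l * R) (l.map Prod.snd) := by
  have hR0 : R ≠ 0 := by rintro rfl; exact hR 0 (by simp)
  have h0 : rp l * R ≠ 0 := mul_ne_zero (rp_monic l).ne_zero hR0
  rw [hasPattern_iff]
  refine ⟨h0, l, rfl, hl, fun p hp => ?_, fun y hy => ?_⟩
  · rw [rootMultiplicity_mul h0, rp_mult l hl p hp, rootMultiplicity_eq_zero (hR _), add_zero]
  · by_contra! hcon
    have h1 := rp_mult_of_notMem l y hcon
    rw [← rootMultiplicity_pos h0, rootMultiplicity_mul h0, h1, rootMultiplicity_eq_zero (hR _)] at hy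
    simp at hy

theorem factor_aux (l : List (ℝ × PNat)) : ∀ (P : ℝ[X]), P ≠ 0 → SS l →
    (∀ p ∈ l, rootMultiplicity p.1 P = (p.2 : ℕ)) → ∃ R, P = rp l * R := by
  induction l with
  | nil => intro P _ _ _; exact ⟨P, by simp [rp_nil]⟩
  | cons q l ih =>
    intro P hP hl hm
    rw [SS, List.pairwise_cons] at hl
    obtain ⟨P', hP'⟩ := pow_rootMultiplicity_dvd P q.1
    rw [hm q (by simp)] at hP'
    have hP0 : P' ≠ 0 := by rintro rfl; simp at hP'; exact hP hP'
    obtain ⟨R, hR⟩ := ih P' hP0 hl.2 (fun p hp => by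
      rw [← hm p (by simp [hp]), hP', rootMultiplicity_mul (hP' ▸ hP),
        rootMultiplicity_eq_zero (p := (X - C q.1) ^ (q.2 : ℕ)), zero_add]
      simp only [IsRoot.def, eval_pow, eval_sub, eval_X, eval_C]
      exact pow_ne_zero _ (sub_ne_zero.2 (hl.1 p hp).ne'))
    exact ⟨R, by rw [rp_cons, mul_assoc, ← hR, hP']⟩

theorem hasPattern_factor {P : ℝ[X]} {ω : Comp} (h : hasPattern P ω) :
    ∃ l, l.map Prod.snd = ω ∧ SS l ∧ ∃ R : ℝ[X], (∀ y, ¬ R.IsRoot y) ∧ P = rp l * R := by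
  obtain ⟨h0, l, rfl, hs, hm, hr⟩ := (hasPattern_iff _ _).1 h
  obtain ⟨R, hR⟩ := factor_aux l P h0 hs hm
  refine ⟨l, rfl, hs, R, fun y hy => ?_, hR⟩
  have hR0 : R ≠ 0 := by rintro rfl; simp at hR; exact h0 hR
  obtain ⟨p, hp, rfl⟩ := hr y (by rw [hR, IsRoot.def, eval_mul, hy.eq_zero, mul_zero])
  have h1 := hm p hp
  rw [hR, rootMultiplicity_mul (hR ▸ h0), rp_mult l hs p hp] at h1
  have := (rootMultiplicity_pos hR0).2 hy
  omega

theorem polyOfVec_coeff (d : ℕ) (a : Fin (d + 1) → ℝ) (n : ℕ) :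
    (polyOfVec d a).coeff n = if h : n < d + 1 then a ⟨n, h⟩ else 0 := by
  simp only [polyOfVec, finsetSum_coeff, coeff_C_mul, coeff_X_pow]
  split_ifs with h
  · rw [Finset.sum_eq_single ⟨n, h⟩]
    · simp
    · intro b _ hb
      have : n ≠ (b : ℕ) := fun e => hb (Fin.ext e.symm)
      simp [this]
    · simp
  · apply Finset.sum_eq_zero
    intro b _
    have : n ≠ (b : ℕ) := by omega
    simp [this]

theorem polyOfVec_coeff_fin (d : ℕ) (a : Fin (d + 1) → ℝ) (i : Fin (d + 1)) :
    (polyOfVec d a).coeff i = a i := by rw [polyOfVec_coeff, dif_pos i.2]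

theorem polyOfVec_natDegree (d : ℕ) (a : Fin (d + 1) → ℝ) : (polyOfVec d a).natDegree ≤ d := by
  rw [natDegree_le_iff_coeff_eq_zero]
  intro N hN
  rw [polyOfVec_coeff, dif_neg (by omega)]

/-- coefficient vector -/
def vec (d : ℕ) (P : ℝ[X]) : Fin (d + 1) → ℝ := fun i => P.coeff i

theorem polyOfVec_vec (d : ℕ) (P : ℝ[X]) (h : P.natDegree ≤ d) : polyOfVec d (vec d P) = P := by
  ext n
  rw [polyOfVec_coeff]
  split_ifs with hn
  · rfl
  · rw [coeff_eq_zero_of_natDegree_lt (by omega)]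

theorem vec_polyOfVec (d : ℕ) (a : Fin (d + 1) → ℝ) : vec d (polyOfVec d a) = a := by
  ext i; exact polyOfVec_coeff_fin d a i

/-- families of polynomials with continuous coefficients -/
def CC {T : Type} [TopologicalSpace T] (F : T → ℝ[X]) : Prop := ∀ n, Continuous fun t => (F t).coeff n

section
variable {T : Type} [TopologicalSpace T]
theorem CC.const (P : ℝ[X]) : CC fun _ : T => P := fun _ => continuous_const
theorem CC.cc {f : T → ℝ} (hf : Continuous f) : CC fun t => C (f t) := fun n => by
  simp only [coeff_C]; split_ifs <;> fun_prop
theorem CC.add {F G : T → ℝ[X]} (hF : CC F) (hG : CC G) : CC fun t => F t + G t := fun n => by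
  simp only [coeff_add]; exact (hF n).add (hG n)
theorem CC.sub {F G : T → ℝ[X]} (hF : CC F) (hG : CC G) : CC fun t => F t - G t := fun n => by
  simp only [coeff_sub]; exact (hF n).sub (hG n)
theorem CC.mul {F G : T → ℝ[X]} (hF : CC F) (hG : CC G) : CC fun t => F t * G t := fun n => by
  simp only [coeff_mul]
  exact continuous_finsetSum _ fun i _ => (hF _).mul (hG _)
theorem CC.pow {F : T → ℝ[X]} (hF : CC F) (m : ℕ) : CC fun t => F t ^ m := by
  induction m with
  | zero => simpa using CC.const 1
  | succ m ih => simpa only [pow_succ] using ih.mul hF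
theorem CC.prod {ι : Type} {F : ι → T → ℝ[X]} (s : Finset ι) (hF : ∀ i, CC (F i)) :
    CC fun t => ∏ i ∈ s, F i t := by
  classical
  induction s using Finset.induction_on with
  | empty => simpa using CC.const 1
  | insert a s ha ih => simpa only [Finset.prod_insert ha] using (hF a).mul ih
theorem CC.vec {F : T → ℝ[X]} (hF : CC F) (d : ℕ) : Continuous fun t => vec d (F t) :=
  continuous_pi fun i => hF i
theorem CC.poly {d : ℕ} {f : T → Fin (d + 1) → ℝ} (hf : Continuous f) : CC fun t => polyOfVec d (f t) :=
  fun n => by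
    simp only [polyOfVec_coeff]
    split_ifs
    · exact (continuous_apply _).comp hf
    · exact continuous_const
end

theorem closed_limit (d : ℕ) (Θ : Set MComp)
    (hcl : IsClosed {a : {v : Fin (d + 1) → ℝ // v ≠ 0} | ∃ x ∈ Θ, markedPattern d a.1 x})
    (F : ℝ → ℝ[X]) (hc : CC F) (hdeg : ∀ t, (F t).natDegree ≤ d) (x y : MComp) (hx : x ∈ Θ)
    (hFx : ∀ t, 0 < t → t < 1 → hasPattern (F t) x.1 ∧ x.2 = d - (F t).natDegree)
    (hFy : hasPattern (F 0) y.1 ∧ y.2 = d - (F 0).natDegree) : y ∈ Θ := by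
  obtain ⟨K, hK, hKe⟩ := isClosed_induced_iff.1 hcl
  have hne : ∀ P : ℝ[X], P ≠ 0 → P.natDegree ≤ d → vec d P ≠ 0 := by
    intro P hP hd h
    apply hP
    rw [← polyOfVec_vec d P hd, h]
    simp [polyOfVec]
  have hpre : IsClosed {t | vec d (F t) ∈ K} := hK.preimage (hc.vec d)
  have hsub : Set.Ioo (0 : ℝ) 1 ⊆ {t | vec d (F t) ∈ K} := by
    intro t ht
    have h := hFx t ht.1 ht.2
    have : (⟨vec d (F t), hne _ h.1.1 (hdeg t)⟩ : {v : Fin (d + 1) → ℝ // v ≠ 0}) ∈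
      Subtype.val ⁻¹' K := by
      rw [hKe]
      refine ⟨x, hx, ?_⟩
      simpa only [markedPattern, polyOfVec_vec d _ (hdeg t)] using h
    exact this
  have h0 : (0 : ℝ) ∈ {t | vec d (F t) ∈ K} := by
    apply closure_minimal hsub hpre
    rw [closure_Ioo (by norm_num)]
    simp
  have : (⟨vec d (F 0), hne _ hFy.1.1 (hdeg 0)⟩ : {v : Fin (d + 1) → ℝ // v ≠ 0}) ∈
      Subtype.val ⁻¹' K := h0
  rw [hKe] at this
  obtain ⟨z, hz, hz1, hz2⟩ := this
  simp only [polyOfVec_vec d _ (hdeg 0)] at hz1 hz2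
  have : y = z := Prod.ext (hasPattern_unique hFy.1 hz1) (hFy.2.trans hz2.symm)
  exact this ▸ hz

theorem exists_gt (u : Comp) : ∀ c : ℝ, ∃ l : List (ℝ × PNat), l.map Prod.snd = u ∧ SS l ∧
    ∀ p ∈ l, c < p.1 := by
  induction u with
  | nil => intro c; exact ⟨[], rfl, List.Pairwise.nil, by simp⟩
  | cons a u ih =>
    intro c
    obtain ⟨l, h1, h2, h3⟩ := ih (c + 1)
    refine ⟨(c + 1, a) :: l, by simp [h1], List.pairwise_cons.2 ⟨h3, h2⟩, ?_⟩
    intro p hp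
    rcases List.mem_cons.1 hp with rfl | hp
    · simp
    · linarith [h3 p hp]

theorem exists_lt' (u : Comp) : ∀ c : ℝ, ∃ l : List (ℝ × PNat), l.map Prod.snd = u ∧ SS l ∧
    ∀ p ∈ l, p.1 < c := by
  induction u using List.reverseRecOn with
  | nil => intro c; exact ⟨[], rfl, List.Pairwise.nil, by simp⟩
  | append_singleton u a ih =>
    intro c
    obtain ⟨l, h1, h2, h3⟩ := ih (c - 1)
    refine ⟨l ++ [(c - 1, a)], by simp [h1], List.pairwise_append.2 ⟨h2, by simp, ?_⟩, ?_⟩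
    · intro p hp q hq
      simp at hq
      subst hq
      exact h3 p hp
    intro p hp
    rcases List.mem_append.1 hp with hp | hp
    · linarith [h3 p hp]
    · simp at hp
      subst hp
      simp

theorem mergeAux_spec (ω : Comp) : ∀ k, k + 2 ≤ ω.length → ∃ u a b v, ω = u ++ a :: b :: v ∧
    mergeAux ω k = u ++ (a + b) :: v := by
  induction ω with
  | nil => intro k hk; simp at hk
  | cons a t ih =>
    intro k hk
    cases k with
    | zero =>
      cases t with
      | nil => simp at hk
      | cons b t => exact ⟨[], a, b, t, rfl, rfl⟩
    | succ n =>
      obtain ⟨u, a', b, v, h1, h2⟩ := ih n (by simp at hk ⊢; omega)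
      refine ⟨a :: u, a', b, v, by simp [h1], ?_⟩
      have : mergeAux (a :: t) (n + 1) = a :: mergeAux t n := by
        cases t <;> rfl
      rw [this, h2]; rfl

theorem mergeAux_eq (u : Comp) (a b : PNat) (v : Comp) :
    mergeAux (u ++ a :: b :: v) u.length = u ++ (a + b) :: v := by
  induction u with
  | nil => rfl
  | cons c u ih =>
    have : ∀ t n, mergeAux (c :: t) (n + 1) = c :: mergeAux t n := by
      intro t n; cases t <;> rfl
    simp [this, ih]

/-- Four kinds of elementary steps. -/
inductive Step : MComp → MComp → Prop
  | merge (u : Comp) (a b : PNat) (v : Comp) (κ : ℕ) :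
      Step (u ++ a :: b :: v, κ) (u ++ (a + b) :: v, κ)
  | left (a : PNat) (v : Comp) (κ : ℕ) : Step (a :: v, κ) (v, κ + a)
  | right (a : PNat) (u : Comp) (κ : ℕ) : Step (u ++ [a], κ) (u, κ + a)
  | insert (u v : Comp) (κ : ℕ) : Step (u ++ v, κ) (u ++ 2 :: v, κ)

theorem step_of_mstep {x y : MComp} (h : mstep x y) : Step x y := by
  obtain ⟨ω, κ⟩ := x
  rcases h with ⟨k, hk, hne, rfl⟩ | ⟨k, hk, rfl⟩
  · simp only at hk hne
    unfold mergeM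
    simp only
    split_ifs with h1 h2
    · cases ω with
      | nil => exact absurd rfl hne
      | cons a t => exact Step.left a t κ
    · rcases List.eq_nil_or_concat' ω with rfl | ⟨u, a, rfl⟩
      · exact absurd rfl hne
      · simpa using Step.right a u κ
    · obtain ⟨u, a, b, v, e1, e2⟩ := mergeAux_spec ω (k - 1) (by omega)
      rw [e2, e1]
      exact Step.merge u a b v κ
  · have := Step.insert (ω.take k) (ω.drop k) κ
    rw [List.take_append_drop] at this
    exact this

theorem mstep_of_step {x y : MComp} (h : Step x y) : mstep x y := by
  cases h with
  | merge u a b v κ =>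
    refine Or.inl ⟨u.length + 1, by simp, by simp, ?_⟩
    unfold mergeM
    simp [mergeAux_eq]
  | left a v κ =>
    exact Or.inl ⟨0, by simp, by simp, by simp [mergeM]⟩
  | right a u κ =>
    refine Or.inl ⟨u.length + 1, by simp, by simp, ?_⟩
    unfold mergeM
    simp
  | insert u v κ =>
    exact Or.inr ⟨u.length, by simp, by simp [insertM, insertC]⟩

theorem Step.norm_le {x y : MComp} (h : Step x y) : normM x ≤ normM y := by
  cases h <;> simp [normM, normC_append, normC_cons, normC_nil] <;> omega

theorem Step.norm_parity {x y : MComp} (h : Step x y) : normM x % 2 = normM y % 2 := by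
  cases h <;> simp [normM, normC_append, normC_cons, normC_nil] <;> omega

/-- the rootless filler -/
noncomputable def fil (k : ℕ) : ℝ[X] := (X ^ 2 + C 1) ^ k

theorem quad_monic (c : ℝ) : (X ^ 2 + C c : ℝ[X]).Monic := monic_X_pow_add_C c (by norm_num)

theorem fil_monic (k : ℕ) : (fil k).Monic := (quad_monic 1).pow k

theorem fil_natDegree (k : ℕ) : (fil k).natDegree = 2 * k := by
  rw [fil, (quad_monic 1).natDegree_pow, natDegree_X_pow_add_C, mul_comm]

theorem fil_root (k : ℕ) (y : ℝ) : ¬ (fil k).IsRoot y := by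
  simp only [fil, IsRoot.def, eval_pow, eval_add, eval_X, eval_C]
  positivity

theorem rp_mul_natDegree (l : List (ℝ × PNat)) (R : ℝ[X]) (hR : R ≠ 0) :
    (rp l * R).natDegree = normC (l.map Prod.snd) + R.natDegree := by
  rw [(rp_monic l).natDegree_mul' hR, rp_natDegree]

theorem closed_step (d : ℕ) (Θ : Set MComp)
    (hcl : IsClosed {a : {v : Fin (d + 1) → ℝ // v ≠ 0} | ∃ x ∈ Θ, markedPattern d a.1 x})
    (x y : MComp) (hx : x ∈ Θ) (h : Step x y) (hn : normM y ≤ d) (hp : normM y % 2 = d % 2) :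
    y ∈ Θ := by
  obtain ⟨k, hk⟩ : ∃ k, d = normM y + 2 * k := ⟨(d - normM y) / 2, by omega⟩
  have hf0 := (fil_monic k).ne_zero
  cases h with
  | merge u a b v κ =>
    obtain ⟨u', hu, su, bu⟩ := exists_lt' u 0
    obtain ⟨v', hv, sv, bv⟩ := exists_gt v 1
    simp only [normM, normC_append, normC_cons, PNat.add_coe] at hk
    have deg : ∀ t : ℝ, (rp (u' ++ (0, a) :: (t, b) :: v') * fil k).natDegree + κ = d := by
      intro t
      rw [rp_mul_natDegree _ _ hf0, fil_natDegree]
      simp [normC_append, normC_cons, hu, hv]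
      omega
    have e0 : rp (u' ++ (0, a) :: (0, b) :: v') = rp (u' ++ (0, a + b) :: v') := by
      simp only [rp_append, rp_cons, PNat.add_coe, pow_add]; ring
    refine closed_limit d Θ hcl (fun t => rp (u' ++ (0, a) :: (t, b) :: v') * fil k) ?_
      (fun t => by have := deg t; omega) _ _ hx ?_ ?_
    · simp only [rp_append, rp_cons]
      exact ((CC.const _).mul ((CC.const _).mul
        ((((CC.const _).sub (CC.cc continuous_id)).pow _).mul (CC.const _)))).mul (CC.const _)
    · intro t h0 h1
      refine ⟨?_, by have := deg t; dsimp only; omega⟩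
      have := hasPattern_of (u' ++ (0, a) :: (t, b) :: v') ?_ (fil k) (fil_root k)
      · simpa [hu, hv] using this
      · refine List.pairwise_append.2 ⟨su, List.pairwise_cons.2 ⟨?_, List.pairwise_cons.2 ⟨?_, sv⟩⟩, ?_⟩
        · intro p hp
          rcases List.mem_cons.1 hp with rfl | hp
          · exact h0
          · have := bv p hp; dsimp only; linarith
        · intro p hp
          have := bv p hp; dsimp only; linarith
        · intro p hp q hq
          have := bu p hp
          rcases List.mem_cons.1 hq with rfl | hq
          · exact this
          rcases List.mem_cons.1 hq with rfl | hq
          · dsimp only; linarith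
          · have := bv q hq; linarith
    · refine ⟨?_, by have := deg 0; dsimp only; omega⟩
      dsimp only
      rw [e0]
      have := hasPattern_of (u' ++ (0, a + b) :: v') ?_ (fil k) (fil_root k)
      · simpa [hu, hv] using this
      · refine List.pairwise_append.2 ⟨su, List.pairwise_cons.2 ⟨?_, sv⟩, ?_⟩
        · intro p hp
          have := bv p hp; dsimp only; linarith
        · intro p hp q hq
          have := bu p hp
          rcases List.mem_cons.1 hq with rfl | hq
          · exact this
          · have := bv q hq; linarith
  | left a v κ =>
    obtain ⟨v', hv, sv, bv⟩ := exists_gt v 0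
    simp only [normM] at hk
    have e : ∀ t : ℝ, 0 < t → rp v' * ((C t * X + C 1) ^ (a : ℕ) * fil k) =
        rp ((-1 / t, a) :: v') * (C (t ^ (a : ℕ)) * fil k) := by
      intro t ht
      have : (C t * X + C 1 : ℝ[X]) = C t * (X - C (-1 / t)) := by
        rw [mul_sub, ← C_mul, mul_div_cancel₀ _ ht.ne', C_neg]; ring
      rw [this, mul_pow, rp_cons, C_pow]; ring
    have deg0 : (rp v' * ((C 0 * X + C 1) ^ (a : ℕ) * fil k)).natDegree + κ + a = d := by
      have : (C 0 * X + C 1 : ℝ[X]) = 1 := by simp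
      rw [this, one_pow, one_mul, rp_mul_natDegree _ _ hf0, fil_natDegree, hv]
      omega
    have hC : ∀ t : ℝ, t ≠ 0 → C (t ^ (a : ℕ)) * fil k ≠ 0 := fun t ht =>
      mul_ne_zero (C_ne_zero.2 (pow_ne_zero _ ht)) hf0
    have deg : ∀ t : ℝ, 0 < t →
        (rp v' * ((C t * X + C 1) ^ (a : ℕ) * fil k)).natDegree + κ = d := by
      intro t ht
      rw [e t ht, rp_mul_natDegree _ _ (hC t ht.ne'),
        natDegree_C_mul (pow_ne_zero _ ht.ne'), fil_natDegree]
      simp [normC_cons, hv]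
      omega
    refine closed_limit d Θ hcl (fun t => rp v' * ((C (max t 0) * X + C 1) ^ (a : ℕ) * fil k)) ?_
      (fun t => ?_) _ _ hx ?_ ?_
    · exact (CC.const _).mul (((((CC.cc (by fun_prop)).mul (CC.const _)).add
        (CC.const _)).pow _).mul (CC.const _))
    · rcases (le_max_right t 0).eq_or_lt with h | h
      · rw [← h]; omega
      · have := deg _ h; omega
    · intro t h0 h1
      dsimp only
      rw [max_eq_left h0.le]
      refine ⟨?_, by have := deg t h0; omega⟩
      rw [e t h0]
      have := hasPattern_of ((-1 / t, a) :: v') ?_ (C (t ^ (a : ℕ)) * fil k) ?_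
      · simpa [hv] using this
      · refine List.pairwise_cons.2 ⟨fun p hp => ?_, sv⟩
        have := bv p hp
        have h2 : -1 / t < 0 := div_neg_of_neg_of_pos (by norm_num) h0
        exact h2.trans this
      · intro y hy
        rw [IsRoot.def, eval_mul, eval_C] at hy
        exact mul_ne_zero (pow_ne_zero _ h0.ne') (fil_root k y) hy
    · dsimp only
      rw [max_self]
      refine ⟨?_, by omega⟩
      have := hasPattern_of v' sv (fil k) (fil_root k)
      simpa [hv] using this
  | right a u κ =>
    obtain ⟨v', hv, sv, bv⟩ := exists_lt' u 0
    simp only [normM] at hk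
    have e : ∀ t : ℝ, 0 < t → rp v' * ((C (-t) * X + C 1) ^ (a : ℕ) * fil k) =
        rp (v' ++ [(1 / t, a)]) * (C ((-t) ^ (a : ℕ)) * fil k) := by
      intro t ht
      have : (C (-t) * X + C 1 : ℝ[X]) = C (-t) * (X - C (1 / t)) := by
        rw [mul_sub, ← C_mul, neg_mul, mul_div_cancel₀ _ ht.ne', C_neg, C_neg]; ring
      rw [this, mul_pow, rp_append, rp_cons, rp_nil, C_pow]; ring
    have deg0 : (rp v' * ((C (-0) * X + C 1) ^ (a : ℕ) * fil k)).natDegree + κ + a = d := by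
      have : (C (-0) * X + C 1 : ℝ[X]) = 1 := by simp
      rw [this, one_pow, one_mul, rp_mul_natDegree _ _ hf0, fil_natDegree, hv]
      omega
    have hC : ∀ t : ℝ, t ≠ 0 → C (t ^ (a : ℕ)) * fil k ≠ 0 := fun t ht =>
      mul_ne_zero (C_ne_zero.2 (pow_ne_zero _ ht)) hf0
    have deg : ∀ t : ℝ, 0 < t →
        (rp v' * ((C (-t) * X + C 1) ^ (a : ℕ) * fil k)).natDegree + κ = d := by
      intro t ht
      rw [e t ht, rp_mul_natDegree _ _ (hC _ (neg_ne_zero.2 ht.ne')),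
        natDegree_C_mul (pow_ne_zero _ (neg_ne_zero.2 ht.ne')), fil_natDegree]
      simp [normC_cons, normC_append, normC_nil, hv]
      omega
    refine closed_limit d Θ hcl (fun t => rp v' * ((C (-max t 0) * X + C 1) ^ (a : ℕ) * fil k)) ?_
      (fun t => ?_) _ _ hx ?_ ?_
    · exact (CC.const _).mul (((((CC.cc (by fun_prop)).mul (CC.const _)).add
        (CC.const _)).pow _).mul (CC.const _))
    · rcases (le_max_right t 0).eq_or_lt with h | h
      · rw [← h]; omega
      · have := deg _ h; omega
    · intro t h0 h1
      dsimp only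
      rw [max_eq_left h0.le]
      refine ⟨?_, by have := deg t h0; omega⟩
      rw [e t h0]
      have := hasPattern_of (v' ++ [(1 / t, a)]) ?_ (C ((-t) ^ (a : ℕ)) * fil k) ?_
      · simpa [hv] using this
      · refine List.pairwise_append.2 ⟨sv, by simp, fun p hp q hq => ?_⟩
        simp only [List.mem_singleton] at hq
        subst hq
        have := bv p hp
        have h2 : 0 < 1 / t := by positivity
        exact this.trans h2
      · intro y hy
        rw [IsRoot.def, eval_mul, eval_C] at hy
        exact mul_ne_zero (pow_ne_zero _ (neg_ne_zero.2 h0.ne')) (fil_root k y) hy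
    · dsimp only
      rw [max_self]
      refine ⟨?_, by omega⟩
      have := hasPattern_of v' sv (fil k) (fil_root k)
      simpa [hv] using this
  | insert u v κ =>
    obtain ⟨u', hu, su, bu⟩ := exists_lt' u 0
    obtain ⟨v', hv, sv, bv⟩ := exists_gt v 0
    simp only [normM, normC_append, normC_cons] at hk
    have h2 : ((2 : PNat) : ℕ) = 2 := rfl
    rw [h2] at hk
    have suv : SS (u' ++ v') := List.pairwise_append.2 ⟨su, sv, fun p hp q hq =>
      (bu p hp).trans (bv q hq)⟩
    have deg : ∀ t : ℝ, (rp (u' ++ v') * ((X ^ 2 + C (t ^ 2)) * fil k)).natDegree + κ = d := by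
      intro t
      rw [rp_mul_natDegree _ _ (mul_ne_zero (quad_monic _).ne_zero hf0),
        (quad_monic _).natDegree_mul (fil_monic k), fil_natDegree, natDegree_X_pow_add_C]
      simp [normC_append, hu, hv]
      omega
    have e0 : rp (u' ++ v') * ((X ^ 2 + C (0 ^ 2)) * fil k) =
        rp (u' ++ (0, 2) :: v') * fil k := by
      simp only [rp_append, rp_cons, h2]; simp; ring
    refine closed_limit d Θ hcl (fun t => rp (u' ++ v') * ((X ^ 2 + C (t ^ 2)) * fil k)) ?_
      (fun t => by have := deg t; omega) _ _ hx ?_ ?_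
    · exact (CC.const _).mul (((CC.const _).add (CC.cc (by fun_prop))).mul (CC.const _))
    · intro t h0 h1
      refine ⟨?_, by have := deg t; dsimp only; omega⟩
      have := hasPattern_of (u' ++ v') suv ((X ^ 2 + C (t ^ 2)) * fil k) ?_
      · simpa [hu, hv] using this
      · intro y hy
        rw [IsRoot.def, eval_mul] at hy
        refine mul_ne_zero ?_ (fil_root k y) hy
        simp only [eval_add, eval_pow, eval_X, eval_C]
        positivity
    · refine ⟨?_, by have := deg 0; dsimp only; omega⟩
      dsimp only
      rw [e0]
      have := hasPattern_of (u' ++ (0, 2) :: v') ?_ (fil k) (fil_root k)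
      · simpa [hu, hv] using this
      · refine List.pairwise_append.2 ⟨su, List.pairwise_cons.2 ⟨bv, sv⟩, ?_⟩
        intro p hp q hq
        have := bu p hp
        rcases List.mem_cons.1 hq with rfl | hq
        · exact this
        · exact this.trans (bv q hq)

theorem forward (d : ℕ) (Θ : Set MComp)
    (hsub : Θ ⊆ {x : MComp | normM x ≤ d ∧ normM x % 2 = d % 2})
    (hcl : IsClosed {a : {v : Fin (d + 1) → ℝ // v ≠ 0} | ∃ x ∈ Θ, markedPattern d a.1 x})
    (x : MComp) (hx : x ∈ Θ) (y : MComp) (h : mprec y x) (hn : normM y ≤ d) : y ∈ Θ := by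
  unfold mprec at h
  induction h with
  | refl => exact hx
  | tail _ hs ih =>
    have hs := step_of_mstep hs
    have h1 := ih (hs.norm_le.trans hn)
    exact closed_step d Θ hcl _ _ h1 hs hn (hs.norm_parity ▸ (hsub h1).2)

/-- Linear form vanishing at `tan θ`. -/
noncomputable def lf (θ : ℝ) : ℝ[X] := C (Real.cos θ) * X - C (Real.sin θ)

/-- Product of powers of linear forms. -/
noncomputable def lpr (l : List (ℝ × PNat)) : ℝ[X] := (l.map fun p => lf p.1 ^ (p.2 : ℕ)).prod

theorem lpr_nil : lpr [] = 1 := rfl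
theorem lpr_cons (p : ℝ × PNat) (l : List (ℝ × PNat)) :
    lpr (p :: l) = lf p.1 ^ (p.2 : ℕ) * lpr l := by simp [lpr]
theorem lpr_append (s t : List (ℝ × PNat)) : lpr (s ++ t) = lpr s * lpr t := by simp [lpr]

theorem lf_ne_zero (θ : ℝ) : lf θ ≠ 0 := by
  intro h
  have h0 := congrArg (fun P => coeff P 0) h
  have h1 := congrArg (fun P => coeff P 1) h
  simp [lf] at h0
  simp [lf, coeff_C] at h1
  have := Real.sin_sq_add_cos_sq θ
  rw [h0, h1] at this
  norm_num at this

theorem lf_natDegree (θ : ℝ) : (lf θ).natDegree ≤ 1 := by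
  unfold lf
  compute_degree

theorem lf_tan {θ : ℝ} (h : Real.cos θ ≠ 0) : lf θ = C (Real.cos θ) * (X - C (Real.tan θ)) := by
  rw [lf, mul_sub, ← C_mul, Real.tan_eq_sin_div_cos, mul_div_cancel₀ _ h]

theorem lf_left : lf (-(Real.pi / 2)) = 1 := by
  simp [lf]

theorem lf_right : lf (Real.pi / 2) = -1 := by
  simp [lf]

theorem lpr_ne_zero (l : List (ℝ × PNat)) : lpr l ≠ 0 := by
  induction l with
  | nil => simp [lpr_nil]
  | cons p l ih => rw [lpr_cons]; exact mul_ne_zero (pow_ne_zero _ (lf_ne_zero _)) ih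

theorem lpr_natDegree (l : List (ℝ × PNat)) : (lpr l).natDegree ≤ normC (l.map Prod.snd) := by
  induction l with
  | nil => simp [lpr_nil]
  | cons p l ih =>
    rw [lpr_cons, List.map_cons, normC_cons]
    refine natDegree_mul_le.trans (add_le_add ?_ ih)
    have := natDegree_pow_le_of_le (p.2 : ℕ) (lf_natDegree p.1)
    simpa using this

theorem lpr_tan (l : List (ℝ × PNat)) : (∀ p ∈ l, Real.cos p.1 ≠ 0) →
    ∃ c : ℝ, c ≠ 0 ∧ lpr l = C c * rp (l.map fun p => (Real.tan p.1, p.2)) := by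
  induction l with
  | nil => intro _; exact ⟨1, one_ne_zero, by simp [lpr_nil, rp_nil]⟩
  | cons p l ih =>
    intro h
    obtain ⟨c, hc, e⟩ := ih (fun q hq => h q (by simp [hq]))
    have hp := h p (by simp)
    refine ⟨Real.cos p.1 ^ (p.2 : ℕ) * c, mul_ne_zero (pow_ne_zero _ hp) hc, ?_⟩
    rw [lpr_cons, List.map_cons, rp_cons, e, lf_tan hp, mul_pow, C_mul, C_pow]
    ring

/-- weakly sorted -/
def WS (l : List (ℝ × PNat)) : Prop := l.Pairwise fun p q => p.1 ≤ q.1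

/-- angles in range -/
def BD (l : List (ℝ × PNat)) : Prop := ∀ p ∈ l, p.1 ∈ Set.Icc (-(Real.pi / 2)) (Real.pi / 2)

theorem WS.ss_or (l : List (ℝ × PNat)) (h : WS l) :
    SS l ∨ ∃ u p q v, l = u ++ p :: q :: v ∧ p.1 = q.1 := by
  induction l with
  | nil => exact Or.inl List.Pairwise.nil
  | cons p l ih =>
    rw [WS, List.pairwise_cons] at h
    rcases ih h.2 with h1 | ⟨u, p', q, v, rfl, e⟩
    · cases l with
      | nil => exact Or.inl (List.pairwise_singleton _ _)
      | cons q l =>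
        rcases (h.1 q (by simp)).eq_or_lt with e | e
        · exact Or.inr ⟨[], p, q, l, rfl, e⟩
        · refine Or.inl (List.pairwise_cons.2 ⟨?_, h1⟩)
          intro r hr
          rcases List.mem_cons.1 hr with rfl | hr
          · exact e
          · exact e.trans ((List.pairwise_cons.1 h1).1 r hr)
    · exact Or.inr ⟨p :: u, p', q, v, rfl, e⟩

theorem WS.split (l : List (ℝ × PNat)) (θ : ℝ) (h : WS l) :
    ∃ u v, l = u ++ v ∧ (∀ p ∈ u, p.1 ≤ θ) ∧ ∀ p ∈ v, θ ≤ p.1 := by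
  induction l with
  | nil => exact ⟨[], [], rfl, by simp, by simp⟩
  | cons p l ih =>
    rw [WS, List.pairwise_cons] at h
    by_cases hp : p.1 ≤ θ
    · obtain ⟨u, v, rfl, h1, h2⟩ := ih h.2
      refine ⟨p :: u, v, rfl, ?_, h2⟩
      intro q hq
      rcases List.mem_cons.1 hq with rfl | hq
      · exact hp
      · exact h1 q hq
    · push Not at hp
      refine ⟨[], p :: l, rfl, by simp, ?_⟩
      intro q hq
      rcases List.mem_cons.1 hq with rfl | hq
      · exact hp.le
      · exact hp.le.trans (h.1 q hq)

theorem mprec_of_step {x y z : MComp} (h : Step x y) (h' : mprec z y) : mprec z x :=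
  Relation.ReflTransGen.head (mstep_of_step h) h'

theorem reduce_base (d : ℕ) (n : ℕ) : ∀ (l : List (ℝ × PNat)) (κ : ℕ) (R : ℝ[X]), l.length = n →
    WS l → BD l → (∀ y, ¬ R.IsRoot y) → normC (l.map Prod.snd) + κ + R.natDegree = d →
    ∃ y : MComp, mprec y (l.map Prod.snd, κ) ∧ normM y ≤ d ∧ hasPattern (lpr l * R) y.1 ∧
      y.2 = d - (lpr l * R).natDegree := by
  induction n with
  | zero =>
    intro l κ R hl _ _ hR hd
    obtain rfl := List.length_eq_zero_iff.1 hl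
    refine ⟨([], κ), Relation.ReflTransGen.refl, ?_, ?_, ?_⟩
    · simp [normM, normC_nil] at hd ⊢; omega
    · exact hasPattern_of [] List.Pairwise.nil R hR
    · simp [lpr_nil, normC_nil] at hd ⊢; omega
  | succ n ih =>
    intro l κ R hl hws hbd hR hd
    have hR0 : R ≠ 0 := by rintro rfl; exact hR 0 (by simp)
    rcases hws.ss_or with hss | ⟨u, p, q, v, rfl, e⟩
    swap
    · -- merge
      have hws' : WS (u ++ (p.1, p.2 + q.2) :: v) := by
        have h1 := List.pairwise_append.1 hws
        have h2 := List.pairwise_cons.1 h1.2.1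
        have h3 := List.pairwise_cons.1 h2.2
        refine List.pairwise_append.2 ⟨h1.1, List.pairwise_cons.2 ⟨?_, h3.2⟩, ?_⟩
        · intro r hr; exact h2.1 r (by simp [hr])
        · intro r hr s hs
          rcases List.mem_cons.1 hs with rfl | hs
          · exact h1.2.2 r hr p (by simp)
          · exact h1.2.2 r hr s (by simp [hs])
      have hbd' : BD (u ++ (p.1, p.2 + q.2) :: v) := by
        intro r hr
        rcases List.mem_append.1 hr with hr | hr
        · exact hbd r (by simp [hr])
        rcases List.mem_cons.1 hr with rfl | hr
        · exact hbd p (by simp)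
        · exact hbd r (by simp [hr])
      obtain ⟨y, h1, h2, h3, h4⟩ := ih (u ++ (p.1, p.2 + q.2) :: v) κ R (by simp at hl ⊢; omega)
        hws' hbd' hR (by simp [normC_append, normC_cons] at hd ⊢; omega)
      have e0 : lpr (u ++ (p.1, p.2 + q.2) :: v) = lpr (u ++ p :: q :: v) := by
        simp only [lpr_append, lpr_cons, PNat.add_coe, pow_add, e]; ring
      rw [e0] at h3 h4
      refine ⟨y, mprec_of_step ?_ h1, h2, h3, h4⟩
      have := Step.merge (u.map Prod.snd) p.2 q.2 (v.map Prod.snd) κ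
      simpa using this
    · by_cases hleft : ∃ m v, l = (-(Real.pi / 2), m) :: v
      · obtain ⟨m, v, rfl⟩ := hleft
        obtain ⟨y, h1, h2, h3, h4⟩ := ih v (κ + m) R (by simpa using hl)
          (List.pairwise_cons.1 hws).2 (fun p hp => hbd p (by simp [hp])) hR
          (by simp [normC_cons] at hd ⊢; omega)
        refine ⟨y, mprec_of_step (Step.left m _ κ) h1, h2, ?_⟩
        simpa [lpr_cons, lf_left] using And.intro h3 h4
      by_cases hright : ∃ m u, l = u ++ [(Real.pi / 2, m)]
      · obtain ⟨m, u, rfl⟩ := hright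
        have hs : (-1 : ℝ) ^ (m : ℕ) ≠ 0 := pow_ne_zero _ (by norm_num)
        obtain ⟨y, h1, h2, h3, h4⟩ := ih u (κ + m) (C ((-1) ^ (m : ℕ)) * R) (by simpa using hl)
          (List.pairwise_append.1 hws).1 (fun p hp => hbd p (by simp [hp]))
          (fun y hy => by
            rw [IsRoot.def, eval_mul, eval_C] at hy
            exact mul_ne_zero hs (hR y) hy)
          (by rw [natDegree_C_mul hs]
              simp [normC_cons, normC_append, normC_nil] at hd ⊢; omega)
        have e0 : lpr (u ++ [(Real.pi / 2, m)]) * R = lpr u * (C ((-1) ^ (m : ℕ)) * R) := by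
          rw [lpr_append, lpr_cons, lpr_nil, lf_right]; simp; ring
        rw [e0]
        refine ⟨y, mprec_of_step ?_ h1, h2, h3, h4⟩
        have := Step.right m (u.map Prod.snd) κ
        simpa using this
      · -- all roots finite and distinct
        have hint : ∀ p ∈ l, p.1 ∈ Set.Ioo (-(Real.pi / 2)) (Real.pi / 2) := by
          intro p hp
          have hb := hbd p hp
          refine ⟨lt_of_le_of_ne hb.1 fun h => ?_, lt_of_le_of_ne hb.2 fun h => ?_⟩
          · cases l with
            | nil => simp at hp
            | cons q v =>
              apply hleft
              refine ⟨q.2, v, ?_⟩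
              have : q.1 = -(Real.pi / 2) := by
                have hq := (hbd q (by simp)).1
                rcases List.mem_cons.1 hp with rfl | hp
                · exact h.symm
                · have := (List.pairwise_cons.1 hss).1 p hp
                  linarith
              rw [← this]
          · rcases List.eq_nil_or_concat' l with rfl | ⟨u, q, rfl⟩
            · simp at hp
            · apply hright
              refine ⟨q.2, u, ?_⟩
              have : q.1 = Real.pi / 2 := by
                have hq := (hbd q (by simp)).2
                rcases List.mem_append.1 hp with hp | hp
                · have := (List.pairwise_append.1 hss).2.2 p hp q (by simp)
                  linarith
                · simp at hp; rw [← hp]; exact h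
              rw [← this]
        obtain ⟨c, hc, e⟩ := lpr_tan l fun p hp => (Real.cos_pos_of_mem_Ioo (hint p hp)).ne'
        have hsst : SS (l.map fun p => (Real.tan p.1, p.2)) := by
          rw [SS, List.pairwise_map]
          refine List.Pairwise.imp_of_mem ?_ hss
          intro p q hp hq h
          exact Real.strictMonoOn_tan (hint p hp) (hint q hq) h
        have e1 : lpr l * R = rp (l.map fun p => (Real.tan p.1, p.2)) * (C c * R) := by
          rw [e]; ring
        have hm : (l.map fun p => (Real.tan p.1, p.2)).map Prod.snd = l.map Prod.snd := by
          simp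
        refine ⟨(l.map Prod.snd, κ), Relation.ReflTransGen.refl, by simp only [normM]; omega, ?_, ?_⟩
        · have := hasPattern_of _ hsst (C c * R) (fun y hy => by
            rw [IsRoot.def, eval_mul, eval_C] at hy
            exact mul_ne_zero hc (hR y) hy)
          rw [e1]
          rwa [hm] at this
        · rw [e1, rp_mul_natDegree _ _ (mul_ne_zero (C_ne_zero.2 hc) hR0), hm, natDegree_C_mul hc]
          dsimp only
          omega

theorem even_natDegree_of_nonneg (R : ℝ[X]) (h : ∀ t, 0 ≤ R.eval t) : Even R.natDegree := by
  by_contra hodd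
  rw [Nat.not_even_iff_odd] at hodd
  have key : ∀ Q : ℝ[X], (∀ t, 0 ≤ Q.eval t) → Odd Q.natDegree → 0 ≤ Q.leadingCoeff := by
    intro Q hQ ho
    by_contra! hneg
    have := Q.tendsto_atBot_of_leadingCoeff_nonpos
      (natDegree_pos_iff_degree_pos.1 ho.pos) hneg.le
    obtain ⟨t, ht⟩ := (this.eventually (Filter.eventually_lt_atBot 0)).exists
    exact absurd (hQ t) (not_le.2 ht)
  have h1 := key R h hodd
  have hd : (R.comp (-X)).natDegree = R.natDegree := by
    rw [natDegree_comp]; simp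
  have h2 := key (R.comp (-X)) (fun t => by simpa using h (-t)) (by rw [hd]; exact hodd)
  rw [leadingCoeff_comp (by simp)] at h2
  simp [hodd.neg_one_pow] at h2
  have : R.leadingCoeff = 0 := le_antisymm h2 h1
  rw [leadingCoeff_eq_zero] at this
  simp [this] at hodd

theorem nonneg_root (R : ℝ[X]) (h0 : R ≠ 0) (h : ∀ t, 0 ≤ R.eval t) (r : ℝ) (hr : R.IsRoot r) :
    ∃ S : ℝ[X], R = (X - C r) ^ 2 * S ∧ (∀ t, 0 ≤ S.eval t) ∧ R.natDegree = S.natDegree + 2 := by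
  have hmin : IsLocalMin (fun t => R.eval t) r := Filter.Eventually.of_forall fun t => by
    show R.eval r ≤ R.eval t; rw [hr.eq_zero]; exact h t
  have hder : (derivative R).IsRoot r := by
    have := hmin.deriv_eq_zero
    rwa [Polynomial.deriv] at this
  have hm := (one_lt_rootMultiplicity_iff_isRoot h0).2 ⟨hr, hder⟩
  obtain ⟨S, hS⟩ := (pow_dvd_pow (X - C r) hm).trans (pow_rootMultiplicity_dvd R r)
  have hS0 : S ≠ 0 := by rintro rfl; simp at hS; exact h0 hS
  refine ⟨S, hS, ?_, ?_⟩
  · have hcl : IsClosed {t | 0 ≤ S.eval t} := isClosed_le continuous_const S.continuous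
    have hsub : ({r}ᶜ : Set ℝ) ⊆ {t | 0 ≤ S.eval t} := by
      intro t ht
      have h1 := h t
      rw [hS] at h1
      simp only [eval_mul, eval_pow, eval_sub, eval_X, eval_C] at h1
      have h2 : 0 < (t - r) ^ (Nat.succ 1) := by
        have : t - r ≠ 0 := sub_ne_zero.2 ht
        have := sq_pos_of_ne_zero this
        exact this
      exact nonneg_of_mul_nonneg_right h1 h2
    intro t
    exact closure_minimal hsub hcl ((dense_compl_singleton r) t)
  · rw [hS, ((monic_X_sub_C r).pow _).natDegree_mul' hS0, (monic_X_sub_C r).natDegree_pow]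
    simp; ring

theorem reduce (d : ℕ) (k : ℕ) : ∀ (l : List (ℝ × PNat)) (κ : ℕ) (c : ℝ) (R : ℝ[X]), c ≠ 0 → R ≠ 0 →
    WS l → BD l → (∀ t, 0 ≤ R.eval t) → R.natDegree ≤ 2 * k →
    normC (l.map Prod.snd) + κ + 2 * k = d →
    ∃ y : MComp, mprec y (l.map Prod.snd, κ) ∧ normM y ≤ d ∧
      hasPattern (C c * (lpr l * R)) y.1 ∧ y.2 = d - (C c * (lpr l * R)).natDegree := by
  have base : ∀ (l : List (ℝ × PNat)) (κ : ℕ) (c : ℝ) (R : ℝ[X]), c ≠ 0 →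
      WS l → BD l → (∀ y, ¬ R.IsRoot y) →
      normC (l.map Prod.snd) + κ + R.natDegree = d →
      ∃ y : MComp, mprec y (l.map Prod.snd, κ) ∧ normM y ≤ d ∧
        hasPattern (C c * (lpr l * R)) y.1 ∧ y.2 = d - (C c * (lpr l * R)).natDegree := by
    intro l κ c R hc hws hbd hR hd
    have e : C c * (lpr l * R) = lpr l * (C c * R) := by ring
    rw [e]
    refine reduce_base d _ l κ (C c * R) rfl hws hbd (fun y hy => ?_) ?_
    · rw [IsRoot.def, eval_mul, eval_C] at hy
      exact mul_ne_zero hc (hR y) hy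
    · rw [natDegree_C_mul hc]; exact hd
  have h2 : ((2 : PNat) : ℕ) = 2 := rfl
  induction k with
  | zero =>
    intro l κ c R hc hR hws hbd hpos hdeg hd
    refine base l κ c R hc hws hbd (fun y hy => ?_) (by omega)
    obtain ⟨S, _, _, h⟩ := nonneg_root R hR hpos y hy
    omega
  | succ k ih =>
    intro l κ c R hc hR hws hbd hpos hdeg hd
    by_cases hroot : ∃ r, R.IsRoot r
    · obtain ⟨r, hr⟩ := hroot
      obtain ⟨S, hS, hSpos, hSdeg⟩ := nonneg_root R hR hpos r hr
      have hS0 : S ≠ 0 := by rintro rfl; simp at hS; exact hR hS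
      obtain ⟨u, v, rfl, hu, hv⟩ := hws.split l (Real.arctan r)
      have hw := List.pairwise_append.1 hws
      have hcos := (Real.cos_arctan_pos r).ne'
      obtain ⟨y, h1, h2', h3⟩ := ih (u ++ (Real.arctan r, 2) :: v) κ
        (c / Real.cos (Real.arctan r) ^ 2) S (div_ne_zero hc (pow_ne_zero _ hcos)) hS0
        (List.pairwise_append.2 ⟨hw.1, List.pairwise_cons.2 ⟨hv, hw.2.1⟩, by
          intro p hp q hq
          rcases List.mem_cons.1 hq with rfl | hq
          · exact hu p hp
          · exact hw.2.2 p hp q hq⟩)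
        (by
          intro p hp
          rcases List.mem_append.1 hp with hp | hp
          · exact hbd p (by simp [hp])
          rcases List.mem_cons.1 hp with rfl | hp
          · exact ⟨(Real.neg_pi_div_two_lt_arctan r).le, (Real.arctan_lt_pi_div_two r).le⟩
          · exact hbd p (by simp [hp]))
        hSpos (by omega) (by simp [normC_append, normC_cons, h2] at hd ⊢; omega)
      have e : C (c / Real.cos (Real.arctan r) ^ 2) * (lpr (u ++ (Real.arctan r, 2) :: v) * S) =
          C c * (lpr (u ++ v) * R) := by
        rw [lpr_append, lpr_cons, lpr_append, hS, lf_tan hcos, Real.tan_arctan, h2, mul_pow, ← C_pow]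
        have : C c = C (c / Real.cos (Real.arctan r) ^ 2) * C (Real.cos (Real.arctan r) ^ 2) := by
          rw [← C_mul, div_mul_cancel₀ _ (pow_ne_zero _ hcos)]
        rw [this]; ring
      rw [e] at h3
      refine ⟨y, mprec_of_step ?_ h1, h2', h3⟩
      have := Step.insert (u.map Prod.snd) (v.map Prod.snd) κ
      simpa using this
    · push Not at hroot
      by_cases hfull : R.natDegree = 2 * (k + 1)
      · exact base l κ c R hc hws hbd hroot (by omega)
      · obtain ⟨m, hm⟩ := even_natDegree_of_nonneg R hpos
        obtain ⟨y, h1, h2', h3⟩ := ih ((-(Real.pi / 2), 2) :: l) κ c R hc hR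
          (List.pairwise_cons.2 ⟨fun p hp => (hbd p hp).1, hws⟩)
          (by
            intro p hp
            rcases List.mem_cons.1 hp with rfl | hp
            · exact ⟨le_refl _, by dsimp only; linarith [Real.pi_pos]⟩
            · exact hbd p hp)
          hpos (by omega) (by simp [normC_cons, h2] at hd ⊢; omega)
        have e : lpr ((-(Real.pi / 2), 2) :: l) = lpr l := by
          rw [lpr_cons, lf_left]; simp
        rw [e] at h3
        refine ⟨y, mprec_of_step ?_ h1, h2', h3⟩
        have := Step.insert [] (l.map Prod.snd) κ
        simpa using this

theorem hasPattern_factor_fin {P : ℝ[X]} {ω : Comp} (h : hasPattern P ω) :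
    ∃ x : Fin ω.length → ℝ, StrictMono x ∧ ∃ R : ℝ[X], (∀ y, ¬ R.IsRoot y) ∧
      P = rp (List.ofFn fun i => (x i, ω.get i)) * R := by
  obtain ⟨l, rfl, hs, R, hR, hP⟩ := hasPattern_factor h
  refine ⟨fun i => (l.get (i.cast (by simp))).1, ?_, R, hR, ?_⟩
  · intro i j hij
    exact List.pairwise_iff_get.1 hs _ _ hij
  · rw [hP]
    congr 2
    exact List.ext_getElem (by simp) (by simp)

theorem sign_of_rootless (R : ℝ[X]) (hR : ∀ y, ¬ R.IsRoot y) :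
    ∃ s : ℝ, s * s = 1 ∧ ∀ t, 0 ≤ s * R.eval t := by
  by_cases h1 : ∃ t, R.eval t ≤ 0
  · by_cases h2 : ∃ t, 0 ≤ R.eval t
    · obtain ⟨y, hy⟩ := mem_range_of_exists_le_of_exists_ge R.continuous h1 h2
      exact absurd hy (hR y)
    · push Not at h2
      exact ⟨-1, by norm_num, fun t => by linarith [h2 t]⟩
  · push Not at h1
    exact ⟨1, by norm_num, fun t => by linarith [h1 t]⟩

/-- compact parameter set -/
def KK (d : ℕ) (ω : Comp) (e : ℕ) : Set ((Fin ω.length → ℝ) × (Fin (d + 1) → ℝ)) :=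
  {z | (∀ i, z.1 i ∈ Set.Icc (-(Real.pi / 2)) (Real.pi / 2)) ∧ Monotone z.1 ∧ ‖z.2‖ = 1 ∧
    (∀ t, 0 ≤ (polyOfVec d z.2).eval t) ∧ ∀ i : Fin (d + 1), e < i → z.2 i = 0}

theorem KK_compact (d : ℕ) (ω : Comp) (e : ℕ) : IsCompact (KK d ω e) := by
  have hc : IsCompact ((Set.univ.pi fun _ : Fin ω.length =>
      Set.Icc (-(Real.pi / 2)) (Real.pi / 2)) ×ˢ Metric.sphere (0 : Fin (d + 1) → ℝ) 1) :=
    (isCompact_univ_pi fun _ => isCompact_Icc).prod (isCompact_sphere _ _)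
  refine hc.of_isClosed_subset ?_ ?_
  · have e1 : KK d ω e = {z | ∀ i, z.1 i ∈ Set.Icc (-(Real.pi / 2)) (Real.pi / 2)} ∩
      ({z | ∀ i j, i ≤ j → z.1 i ≤ z.1 j} ∩ ({z | ‖z.2‖ = 1} ∩
      ({z | ∀ t, 0 ≤ (polyOfVec d z.2).eval t} ∩
        {z | ∀ i : Fin (d + 1), e < i → z.2 i = 0}))) := by
      ext z
      simp only [KK, Set.mem_inter_iff, Set.mem_ofPred_eq]
      rfl
    rw [e1]
    refine IsClosed.inter ?_ (IsClosed.inter ?_ (IsClosed.inter ?_ (IsClosed.inter ?_ ?_)))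
    · simp only [Set.ofPred_forall]
      exact isClosed_iInter fun i => isClosed_Icc.preimage (by fun_prop)
    · simp only [Set.ofPred_forall]
      exact isClosed_iInter fun i => isClosed_iInter fun j => isClosed_iInter fun _ =>
        isClosed_le (by fun_prop) (by fun_prop)
    · exact isClosed_eq (by fun_prop) (by fun_prop)
    · simp only [Set.ofPred_forall]
      refine isClosed_iInter fun t => isClosed_le continuous_const ?_
      simp only [polyOfVec, eval_finsetSum, eval_mul, eval_C, eval_pow, eval_X]
      fun_prop
    · simp only [Set.ofPred_forall]
      exact isClosed_iInter fun i => isClosed_iInter fun _ =>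
        isClosed_eq (by fun_prop) (by fun_prop)
  · rintro z ⟨h1, -, h2, -⟩
    exact ⟨fun i _ => h1 i, by simpa using h2⟩

/-- the parametrised polynomial -/
noncomputable def PP (d : ℕ) (ω : Comp) (z : (Fin ω.length → ℝ) × (Fin (d + 1) → ℝ)) : ℝ[X] :=
  lpr (List.ofFn fun i => (z.1 i, ω.get i)) * polyOfVec d z.2

theorem PP_cc (d : ℕ) (ω : Comp) : CC (PP d ω) := by
  have : PP d ω = fun z => (∏ i, lf (z.1 i) ^ (ω.get i : ℕ)) * polyOfVec d z.2 := by
    funext z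
    rw [PP, lpr, List.map_ofFn, List.prod_ofFn]
    rfl
  rw [this]
  refine CC.mul (CC.prod _ fun i => CC.pow ?_ _) (CC.poly continuous_snd)
  unfold lf
  exact ((CC.cc (by fun_prop)).mul (CC.const _)).sub (CC.cc (by fun_prop))

theorem ofFn_snd (ω : Comp) (x : Fin ω.length → ℝ) :
    (List.ofFn fun i => (x i, ω.get i)).map Prod.snd = ω := by
  rw [List.map_ofFn]
  exact List.ofFn_get ω

theorem polyOfVec_smul (d : ℕ) (c : ℝ) (v : Fin (d + 1) → ℝ) :
    polyOfVec d (c • v) = C c * polyOfVec d v := by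
  simp only [polyOfVec, Finset.mul_sum, Pi.smul_apply, smul_eq_mul, C_mul, mul_assoc]

theorem polyOfVec_ne_zero (d : ℕ) (v : Fin (d + 1) → ℝ) (h : v ≠ 0) : polyOfVec d v ≠ 0 := by
  intro h0
  apply h
  rw [← vec_polyOfVec d v, h0]
  ext i
  simp [vec]

theorem KK_props {d : ℕ} {ω : Comp} {e : ℕ} {z} (hz : z ∈ KK d ω e) :
    polyOfVec d z.2 ≠ 0 ∧ (polyOfVec d z.2).natDegree ≤ e := by
  obtain ⟨-, -, h3, -, h5⟩ := hz
  constructor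
  · apply polyOfVec_ne_zero
    intro h
    simp [h] at h3
  · rw [natDegree_le_iff_coeff_eq_zero]
    intro N hN
    rw [polyOfVec_coeff]
    split_ifs with h
    · exact h5 _ hN
    · rfl

theorem PP_natDegree {d : ℕ} {ω : Comp} {e : ℕ} {z} (hz : z ∈ KK d ω e) (he : normC ω + e ≤ d) :
    (PP d ω z).natDegree ≤ d := by
  refine natDegree_mul_le.trans ?_
  have h1 := lpr_natDegree (List.ofFn fun i => (z.1 i, ω.get i))
  rw [ofFn_snd] at h1
  have := (KK_props hz).2
  omega

theorem PP_ne_zero {d : ℕ} {ω : Comp} {e : ℕ} {z} (hz : z ∈ KK d ω e) : PP d ω z ≠ 0 :=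
  mul_ne_zero (lpr_ne_zero _) (KK_props hz).1

theorem cone_closed {n : ℕ} (K : Set (Fin n → ℝ)) (hK : IsCompact K) (h0 : (0 : Fin n → ℝ) ∉ K) :
    IsClosed {a : {v : Fin n → ℝ // v ≠ 0} | ∃ v ∈ K, ∃ c : ℝ, a.1 = c • v} := by
  have hT : IsCompact ((fun p : ℝ × (Fin n → ℝ) => p.1 • ‖p.2‖⁻¹ • p.2) '' (({-1, 1} : Set ℝ) ×ˢ K)) := by
    apply ((Set.toFinite _).isCompact.prod hK).image_of_continuousOn
    have h1 : ContinuousOn (fun p : ℝ × (Fin n → ℝ) => ‖p.2‖⁻¹) (({-1, 1} : Set ℝ) ×ˢ K) := by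
      apply ContinuousOn.inv₀
      · fun_prop
      · rintro ⟨s, v⟩ ⟨_, hv⟩ h
        simp only [norm_eq_zero] at h
        simp only [h] at hv
        exact h0 hv
    exact continuousOn_fst.smul (h1.smul continuousOn_snd)
  have hcont : Continuous fun a : {v : Fin n → ℝ // v ≠ 0} => ‖a.1‖⁻¹ • a.1 := by
    have h1 : Continuous fun a : {v : Fin n → ℝ // v ≠ 0} => ‖a.1‖⁻¹ :=
      Continuous.inv₀ (by fun_prop) fun a => norm_ne_zero_iff.2 a.2
    exact h1.smul continuous_subtype_val
  convert hT.isClosed.preimage hcont using 1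
  ext a
  have ha := norm_ne_zero_iff.2 a.2
  constructor
  · rintro ⟨v, hv, c, hc⟩
    have hc0 : c ≠ 0 := by
      rintro rfl
      rw [zero_smul] at hc
      exact a.2 hc
    refine ⟨(c / |c|, v), ⟨?_, hv⟩, ?_⟩
    · rcases lt_or_gt_of_ne hc0 with h | h
      · left; rw [abs_of_neg h]; field_simp
      · right; rw [abs_of_pos h]; simp [hc0]
    · simp only
      rw [hc, norm_smul, smul_smul, smul_smul, Real.norm_eq_abs]
      congr 1
      rw [mul_inv]; ring
  · rintro ⟨⟨s, v⟩, ⟨_, hv⟩, h⟩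
    refine ⟨v, hv, ‖a.1‖ * (s * ‖v‖⁻¹), ?_⟩
    simp only at h
    rw [mul_smul, mul_smul, h, smul_smul, mul_inv_cancel₀ ha, one_smul]

/-- closed hull of a stratum -/
def DD (d : ℕ) (x : MComp) : Set {v : Fin (d + 1) → ℝ // v ≠ 0} :=
  {a | ∃ v ∈ (fun z => vec d (PP d x.1 z)) '' KK d x.1 (d - normM x), ∃ c : ℝ, a.1 = c • v}

theorem DD_closed (d : ℕ) (x : MComp) (hx : normM x ≤ d) : IsClosed (DD d x) := by
  refine cone_closed _ ((KK_compact _ _ _).image ((PP_cc d x.1).vec d)) ?_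
  rintro ⟨z, hz, h⟩
  simp only [normM] at hx
  have h1 := PP_natDegree hz (by simp only [normM]; omega)
  apply PP_ne_zero hz
  rw [← polyOfVec_vec d _ h1]
  simp only at h
  rw [h]
  simp [polyOfVec]

theorem DD_reduce (d : ℕ) (x : MComp) (hx : normM x ≤ d) (hp : normM x % 2 = d % 2)
    (a : {v : Fin (d + 1) → ℝ // v ≠ 0}) (ha : a ∈ DD d x) :
    ∃ y, mprec y x ∧ normM y ≤ d ∧ markedPattern d a.1 y := by
  obtain ⟨v, ⟨z, hz, rfl⟩, c, hc⟩ := ha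
  have hx' := hx
  simp only [normM] at hx'
  have h1 := PP_natDegree hz (by simp only [normM]; omega)
  have hc0 : c ≠ 0 := by
    rintro rfl
    rw [zero_smul] at hc
    exact a.2 hc
  obtain ⟨k, hk⟩ : ∃ k, d = normM x + 2 * k := ⟨(d - normM x) / 2, by omega⟩
  have hprop := KK_props hz
  have := reduce d k (List.ofFn fun i => (z.1 i, x.1.get i)) x.2 c (polyOfVec d z.2) hc0 hprop.1 ?_ ?_
    hz.2.2.2.1 (by have := hprop.2; omega) (by rw [ofFn_snd]; simp only [normM] at hk; omega)
  · rw [ofFn_snd] at this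
    obtain ⟨y, hy1, hy2, hy3⟩ := this
    refine ⟨y, hy1, hy2, ?_⟩
    rw [markedPattern, hc, polyOfVec_smul, polyOfVec_vec d _ h1]
    exact hy3
  · rw [WS, List.pairwise_ofFn]
    intro i j hij
    exact hz.2.1 hij.le
  · intro p hp
    obtain ⟨i, rfl⟩ := (List.mem_ofFn' _ _).1 hp
    exact hz.1 i

theorem mem_DD (d : ℕ) (x : MComp) (a : {v : Fin (d + 1) → ℝ // v ≠ 0})
    (h : markedPattern d a.1 x) : a ∈ DD d x := by
  obtain ⟨hpat, hκ⟩ := h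
  obtain ⟨r, hr, R, hR, hP⟩ := hasPattern_factor_fin hpat
  have hR0 : R ≠ 0 := by rintro rfl; exact hR 0 (by simp)
  have hdeg : (polyOfVec d a.1).natDegree = normC x.1 + R.natDegree := by
    rw [hP, rp_mul_natDegree _ _ hR0, ofFn_snd]
  have hd := polyOfVec_natDegree d a.1
  have hRd : R.natDegree ≤ d := by omega
  obtain ⟨s, hs, hpos⟩ := sign_of_rootless R hR
  obtain ⟨c, hc, e⟩ := lpr_tan (List.ofFn fun i => (Real.arctan (r i), x.1.get i)) (by
    intro p hp
    obtain ⟨i, rfl⟩ := (List.mem_ofFn' _ _).1 hp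
    exact (Real.cos_arctan_pos _).ne')
  have e1 : (List.ofFn fun i => (Real.arctan (r i), x.1.get i)).map
      (fun p => (Real.tan p.1, p.2)) = List.ofFn fun i => (r i, x.1.get i) := by
    rw [List.map_ofFn]
    congr 1
    funext i
    simp [Real.tan_arctan]
  rw [e1] at e
  have hs0 : s ≠ 0 := by rintro rfl; simp at hs
  have hv : vec d R ≠ 0 := by
    intro h
    apply hR0
    rw [← polyOfVec_vec d R hRd, h]
    simp [polyOfVec]
  have hv' := norm_ne_zero_iff.2 hv
  have hsabs : |s| = 1 := by
    have : |s| * |s| = 1 := by rw [← abs_mul, hs, abs_one]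
    nlinarith [abs_nonneg s]
  have hR1 : polyOfVec d ((s * ‖vec d R‖⁻¹) • vec d R) = C (s * ‖vec d R‖⁻¹) * R := by
    rw [polyOfVec_smul, polyOfVec_vec d R hRd]
  refine ⟨_, ⟨(fun i => Real.arctan (r i), (s * ‖vec d R‖⁻¹) • vec d R), ⟨?_, ?_, ?_, ?_, ?_⟩, rfl⟩,
    c⁻¹ * s * ‖vec d R‖, ?_⟩
  · intro i
    exact ⟨(Real.neg_pi_div_two_lt_arctan _).le, (Real.arctan_lt_pi_div_two _).le⟩
  · intro i j hij
    exact Real.arctan_strictMono.monotone (hr.monotone hij)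
  · simp only
    rw [norm_smul, norm_mul, norm_inv, norm_norm, Real.norm_eq_abs, hsabs, one_mul,
      inv_mul_cancel₀ hv']
  · intro t
    simp only
    rw [hR1, eval_mul, eval_C]
    have := mul_nonneg (inv_nonneg.2 (norm_nonneg (vec d R))) (hpos t)
    linarith
  · intro i hi
    simp only [Pi.smul_apply, vec]
    rw [coeff_eq_zero_of_natDegree_lt, smul_zero]
    simp only [normM] at hi
    omega
  · have key : polyOfVec d a.1 = C (c⁻¹ * s * ‖vec d R‖) *
        PP d x.1 (fun i => Real.arctan (r i), (s * ‖vec d R‖⁻¹) • vec d R) := by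
      rw [PP]
      simp only
      rw [hR1, e, hP]
      have : (1 : ℝ[X]) = C (c⁻¹ * s * ‖vec d R‖) * C c * C (s * ‖vec d R‖⁻¹) := by
        rw [← C_mul, ← C_mul, ← C_1]
        congr 1
        have : c⁻¹ * s * ‖vec d R‖ * c * (s * ‖vec d R‖⁻¹) =
          (c⁻¹ * c) * (s * s) * (‖vec d R‖ * ‖vec d R‖⁻¹) := by ring
        rw [this, hs, inv_mul_cancel₀ hc, mul_inv_cancel₀ hv']; norm_num
      calc _ = 1 * (rp (List.ofFn fun i => (r i, x.1.get i)) * R) := (one_mul _).symm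
        _ = _ := by rw [this]; ring
    have := congrArg (vec d) key
    rw [vec_polyOfVec] at this
    rw [this]
    ext i
    simp only [vec, coeff_C_mul, Pi.smul_apply, smul_eq_mul]

theorem finite_normC (n : ℕ) : {ω : Comp | normC ω ≤ n}.Finite := by
  induction n with
  | zero =>
    refine (Set.finite_singleton []).subset ?_
    rintro ω hω
    cases ω with
    | nil => rfl
    | cons a t =>
      simp [normC_cons] at hω
  | succ n ih =>
    have hf : {a : PNat | (a : ℕ) ≤ n + 1}.Finite :=
      (Set.finite_Iic (n + 1)).preimage PNat.coe_injective.injOn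
    refine ((Set.finite_singleton []).union (hf.image2 List.cons ih)).subset ?_
    rintro ω hω
    cases ω with
    | nil => exact Or.inl rfl
    | cons a t =>
      simp only [Set.mem_ofPred_eq, normC_cons] at hω
      have := a.pos
      exact Or.inr ⟨a, by simp only [Set.mem_ofPred_eq]; omega, t,
        by simp only [Set.mem_ofPred_eq]; omega, rfl⟩

theorem backward (d : ℕ) (Θ : Set MComp)
    (hsub : Θ ⊆ {x : MComp | normM x ≤ d ∧ normM x % 2 = d % 2})
    (h : ∀ x ∈ Θ, ∀ y : MComp, mprec y x → normM y ≤ d → y ∈ Θ) :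
    IsClosed {a : {v : Fin (d + 1) → ℝ // v ≠ 0} | ∃ x ∈ Θ, markedPattern d a.1 x} := by
  have hfin : Θ.Finite := by
    refine ((finite_normC d).prod (Set.finite_Iic d)).subset ?_
    intro x hx
    have := (hsub hx).1
    simp only [normM] at this
    exact ⟨by simp only [Set.mem_ofPred_eq]; omega, by simp only [Set.mem_Iic]; omega⟩
  have e : {a : {v : Fin (d + 1) → ℝ // v ≠ 0} | ∃ x ∈ Θ, markedPattern d a.1 x} =
      ⋃ x ∈ Θ, DD d x := by
    ext a
    simp only [Set.mem_ofPred_eq, Set.mem_iUnion, exists_prop]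
    constructor
    · rintro ⟨x, hx, hm⟩
      exact ⟨x, hx, mem_DD d x a hm⟩
    · rintro ⟨x, hx, hm⟩
      obtain ⟨y, h1, h2, h3⟩ := DD_reduce d x (hsub hx).1 (hsub hx).2 a hm
      exact ⟨y, h x hx y h1 h2, h3⟩
  rw [e]
  exact hfin.isClosed_biUnion fun x hx => DD_closed d x (hsub hx).1

/-- For `d ≥ 1` and `Θ ⊆ Ω^∞_{⟨d]}`, the set of nonzero coefficient vectors
`a ∈ ℝ^{d+1} ∖ {0}` whose marked pattern lies in `Θ` is closed in `ℝ^{d+1} ∖ {0}` if and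
only if `Θ` is closed under `⪯` among marked compositions of norm at most `d`. -/
theorem forms_isClosed_iff_closed_poset (d : ℕ) (hd : 1 ≤ d) (Θ : Set MComp)
    (hsub : Θ ⊆ {x : MComp | normM x ≤ d ∧ normM x % 2 = d % 2}) :
    IsClosed {a : {v : Fin (d + 1) → ℝ // v ≠ 0} | ∃ x ∈ Θ, markedPattern d a.1 x} ↔
      ∀ x ∈ Θ, ∀ y : MComp, mprec y x → normM y ≤ d → y ∈ Θ := by
  exact ⟨fun h x hx y hy hn => forward d Θ hsub h x hx y hy hn, backward d Θ hsub⟩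
end

section
/- For all integers d ≥ 1 and j ≥ 1, the number of nonempty compositions ω with |ω| ≤ d, |ω| ≡ d (mod 2) and |ω|' = d − j equals Σ_{k=0}^{min(⌊(j−1)/2⌋, ⌊(d−1)/2⌋)} binom(d−1−2k, j−1−2k). -/
/-- Increase the first part by one. -/
def incC : Comp → Comp
  | [] => []
  | a :: t => (a + 1) :: t

theorem incC_injective : Function.Injective incC := by
  intro x y h
  cases x <;> cases y <;> simp_all [incC]

/-- The compositions of `n` with `l` parts, as a finset. -/
def compsF : ℕ → ℕ → Finset Comp
  | 0, 0 => {[]}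
  | 0, _ + 1 => ∅
  | _ + 1, 0 => ∅
  | n + 1, l + 1 => (compsF n l).image (List.cons 1) ∪ (compsF n (l + 1)).image incC

theorem mem_compsF (n l : ℕ) (w : Comp) :
    w ∈ compsF n l ↔ normC w = n ∧ w.length = l := by
  induction n generalizing l w with
  | zero =>
    cases l with
    | zero => cases w <;> simp [compsF, normC]
    | succ l => cases w <;> simp [compsF, normC]
  | succ n ih =>
    cases l with
    | zero => cases w <;> simp [compsF, normC]
    | succ l =>
      simp only [compsF, Finset.mem_union, Finset.mem_image, ih]
      constructor
      · rintro (⟨v, ⟨h1, h2⟩, rfl⟩ | ⟨v, ⟨h1, h2⟩, rfl⟩)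
        · simp [normC] at *
          omega
        · cases v with
          | nil => simp at h2
          | cons a t =>
            simp [normC, incC] at *
            omega
      · rintro ⟨h1, h2⟩
        cases w with
        | nil => simp at h2
        | cons a t =>
          by_cases ha : a = 1
          · subst ha
            left
            refine ⟨t, ?_, rfl⟩
            simp [normC] at *
            omega
          · right
            obtain ⟨b, rfl⟩ := PNat.exists_eq_succ_of_ne_one ha
            refine ⟨b :: t, ?_, rfl⟩
            simp [normC] at *
            omega

theorem card_compsF_succ (n l : ℕ) : (compsF (n + 1) (l + 1)).card =
    (compsF n l).card + (compsF n (l + 1)).card := by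
  rw [compsF, Finset.card_union_of_disjoint, Finset.card_image_of_injective,
    Finset.card_image_of_injective _ incC_injective]
  · exact List.cons_injective
  · rw [Finset.disjoint_left]
    intro w hw hw'
    simp only [Finset.mem_image] at hw hw'
    obtain ⟨u, hu, rfl⟩ := hw
    obtain ⟨v, hv, h⟩ := hw'
    cases v with
    | nil => simp [incC] at h
    | cons a t =>
      simp only [incC, List.cons.injEq] at h
      have := congrArg PNat.val h.1
      have h2 := a.pos
      simp at this

theorem card_compsF (n l : ℕ) : (compsF (n + 1) (l + 1)).card = n.choose l := by
  induction n generalizing l with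
  | zero =>
    rw [card_compsF_succ]
    cases l <;> simp [compsF]
  | succ n ih =>
    rw [card_compsF_succ, ih]
    cases l with
    | zero => simp [compsF]
    | succ l => rw [ih, Nat.choose_succ_succ]

theorem length_le_normC (w : Comp) : w.length ≤ normC w := by
  induction w with
  | nil => simp
  | cons a t ih =>
    simp [normC] at *
    have := a.pos
    omega

/-- For `d, j ≥ 1`, the number of nonempty compositions `ω` with
`|ω| ≤ d`, `|ω| ≡ d (mod 2)` and `|ω|' = d - j` equals
`Σ_{k=0}^{min(⌊(j-1)/2⌋, ⌊(d-1)/2⌋)} C(d-1-2k, j-1-2k)`. -/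
theorem count_cells_polynomial_case (d j : ℕ) (hd : 1 ≤ d) (hj : 1 ≤ j) :
    {ω : Comp | ω ≠ [] ∧ normC ω ≤ d ∧ normC ω % 2 = d % 2 ∧
        (rnormC ω : ℤ) = (d : ℤ) - (j : ℤ)}.ncard =
      ∑ k ∈ Finset.range (min ((j - 1) / 2) ((d - 1) / 2) + 1),
        Nat.choose (d - 1 - 2 * k) (j - 1 - 2 * k) := by
  by_cases hjd : d < j
  · rw [Finset.sum_eq_zero]
    · convert Set.ncard_empty Comp
      ext w
      simp only [Set.mem_setOf_eq, Set.mem_empty_iff_false, iff_false]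
      rintro ⟨_, _, _, h⟩
      omega
    · intro k hk
      rw [Finset.mem_range] at hk
      apply Nat.choose_eq_zero_of_lt
      omega
  · have key : {ω : Comp | ω ≠ [] ∧ normC ω ≤ d ∧ normC ω % 2 = d % 2 ∧
        (rnormC ω : ℤ) = (d : ℤ) - (j : ℤ)} =
        (((Finset.range (min ((j - 1) / 2) ((d - 1) / 2) + 1)).biUnion
          fun k => compsF (d - 2 * k) (j - 2 * k) : Finset Comp) : Set Comp) := by
      ext w
      simp only [Set.mem_setOf_eq, Finset.mem_coe, Finset.mem_biUnion, Finset.mem_range,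
        mem_compsF]
      have hl := length_le_normC w
      rw [← List.length_pos_iff_ne_nil, rnormC]
      constructor
      · rintro ⟨h1, h2, h3, h4⟩
        exact ⟨(d - normC w) / 2, by omega, by omega, by omega⟩
      · rintro ⟨k, h1, h2, h3⟩
        refine ⟨by omega, by omega, by omega, by omega⟩
    rw [key, Set.ncard_coe_finset, Finset.card_biUnion]
    · apply Finset.sum_congr rfl
      intro k hk
      rw [Finset.mem_range] at hk
      rw [← card_compsF]
      congr 2 <;> omega
    · intro a ha b hb hab
      rw [Finset.mem_coe, Finset.mem_range] at *
      rw [Function.onFun, Finset.disjoint_left]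
      intro w h1 h2
      rw [mem_compsF] at h1 h2
      omega
end
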